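/- Let N ∈ ℕ and let d, i ∈ {0,…,N} with i ≤ d. Then a set E ⊆ {0,…,N} is (d,i)-admitting if and only if L_{N,d}(E) is (d,i)-admitting. -/

import Mathlib

open MvPolynomial

noncomputable section

namespace CoveringSymmetric

/-- `N = ∑ᵢ (kᵢ - 1)` for the uniform grid `[0,k₁-1] × ⋯ × [0,kₙ-1]`. -/
def Ntot (n : ℕ) (k : Fin n → ℕ) : ℕ := ∑ i, (k i - 1)

/-- The integer points of the uniform grid `G = [0,k₁-1] × ⋯ × [0,kₙ-1]`. -/
def gridSet (n : ℕ) (k : Fin n → ℕ) : Set (Fin n → ℕ) := {x | ∀ i, x i < k i}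

/-- The real point of `ℝⁿ` corresponding to an integer point. -/
def toR {n : ℕ} (x : Fin n → ℕ) : Fin n → ℝ := fun i => (x i : ℝ)

/-- The weight `wt(x) = ∑ᵢ xᵢ` of a point. -/
def wt {n : ℕ} (x : Fin n → ℕ) : ℕ := ∑ i, x i

/-- The weight-determined set `E̲ = {x ∈ G : wt(x) ∈ E}`. -/
def wdSet (n : ℕ) (k : Fin n → ℕ) (E : Finset ℕ) : Set (Fin n → ℕ) :=
  {x ∈ gridSet n k | wt x ∈ E}

/-- The layer `j̲ = {x ∈ G : wt(x) = j}`. -/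
def layer (n : ℕ) (k : Fin n → ℕ) (j : ℕ) : Set (Fin n → ℕ) :=
  {x ∈ gridSet n k | wt x = j}

/-- The grid is strictly unimodal (SU²):
`|0̲| < ⋯ < |⌊N/2⌋̲| = |⌈N/2⌉̲| > ⋯ > |N̲|`. -/
def SU2 (n : ℕ) (k : Fin n → ℕ) : Prop :=
  (∀ j, j < Ntot n k / 2 → (layer n k j).ncard < (layer n k (j + 1)).ncard) ∧
  (layer n k (Ntot n k / 2)).ncard = (layer n k ((Ntot n k + 1) / 2)).ncard ∧
  (∀ j, (Ntot n k + 1) / 2 ≤ j → j < Ntot n k →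
    (layer n k (j + 1)).ncard < (layer n k j).ncard)

/-- The zero set `Z_G(P)` of a polynomial within the grid. -/
def ZG (n : ℕ) (k : Fin n → ℕ) (P : MvPolynomial (Fin n) ℝ) : Set (Fin n → ℕ) :=
  {x ∈ gridSet n k | eval (toR x) P = 0}

/-- The degree-`d` Zariski closure of `S ⊆ G` within the grid. -/
def Zcl (n : ℕ) (k : Fin n → ℕ) (d : ℕ) (S : Set (Fin n → ℕ)) : Set (Fin n → ℕ) :=
  {a ∈ gridSet n k | ∀ P : MvPolynomial (Fin n) ℝ, P.totalDegree ≤ d →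
    (∀ x ∈ S, eval (toR x) P = 0) → eval (toR a) P = 0}

/-- The degree-`d` Z*-closure of a weight-determined set, as a set of weights:
`{j ∈ [0,N] : j̲ ⊆ Z-cl_{G,d}(E̲)}`. -/
def Zstar (n : ℕ) (k : Fin n → ℕ) (d : ℕ) (E : Finset ℕ) : Set ℕ :=
  {j | j ≤ Ntot n k ∧ layer n k j ⊆ Zcl n k d (wdSet n k E)}

/-- `PC_G(E)`: minimum total degree of a nontrivial polynomial cover of `E̲`. -/
def PC (n : ℕ) (k : Fin n → ℕ) (E : Finset ℕ) : ℕ :=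
  sInf {d | ∃ P : MvPolynomial (Fin n) ℝ, P.totalDegree = d ∧
    wdSet n k E ⊆ ZG n k P ∧ ZG n k P ≠ gridSet n k}

/-- `PPC_G(E)`: minimum total degree of a proper polynomial cover of `E̲`. -/
def PPC (n : ℕ) (k : Fin n → ℕ) (E : Finset ℕ) : ℕ :=
  sInf {d | ∃ P : MvPolynomial (Fin n) ℝ, P.totalDegree = d ∧
    wdSet n k E ⊆ ZG n k P ∧
    ∀ j ≤ Ntot n k, j ∉ E → ¬ (layer n k j ⊆ ZG n k P)}

/-- `EPC_G(E)`: minimum total degree of an exact polynomial cover of `E̲`. -/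
def EPC (n : ℕ) (k : Fin n → ℕ) (E : Finset ℕ) : ℕ :=
  sInf {d | ∃ P : MvPolynomial (Fin n) ℝ, P.totalDegree = d ∧ ZG n k P = wdSet n k E}

/-- `x` lies on the affine hyperplane `{y ∈ ℝⁿ : ∑ᵢ wᵢ yᵢ = c}` (with `w ≠ 0`). -/
def onHyp {n : ℕ} (w : Fin n → ℝ) (c : ℝ) (x : Fin n → ℕ) : Prop :=
  ∑ i, w i * (x i : ℝ) = c

/-- `HC_G(E)`: minimum size of a nontrivial hyperplane cover of `E̲`. -/
def HC (n : ℕ) (k : Fin n → ℕ) (E : Finset ℕ) : ℕ :=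
  sInf {m | ∃ (w : Fin m → Fin n → ℝ) (c : Fin m → ℝ), (∀ t, w t ≠ 0) ∧
    (∀ x ∈ wdSet n k E, ∃ t, onHyp (w t) (c t) x) ∧
    ∃ x ∈ gridSet n k, ∀ t, ¬ onHyp (w t) (c t) x}

/-- `PHC_G(E)`: minimum size of a proper hyperplane cover of `E̲`. -/
def PHC (n : ℕ) (k : Fin n → ℕ) (E : Finset ℕ) : ℕ :=
  sInf {m | ∃ (w : Fin m → Fin n → ℝ) (c : Fin m → ℝ), (∀ t, w t ≠ 0) ∧
    (∀ x ∈ wdSet n k E, ∃ t, onHyp (w t) (c t) x) ∧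
    ∀ j ≤ Ntot n k, j ∉ E → ¬ (layer n k j ⊆ {x | ∃ t, onHyp (w t) (c t) x})}

/-- The certifying degree of `S ⊆ G`: least `d ∈ [0,N]` such that some polynomial of
total degree at most `d` is nonconstant on `G` but constant on `S`. -/
def certDeg (n : ℕ) (k : Fin n → ℕ) (S : Set (Fin n → ℕ)) : ℕ :=
  sInf {d | d ≤ Ntot n k ∧ ∃ f : MvPolynomial (Fin n) ℝ, f.totalDegree ≤ d ∧
    (∃ a ∈ gridSet n k, ∃ b ∈ gridSet n k, eval (toR a) f ≠ eval (toR b) f) ∧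
    ∀ a ∈ S, ∀ b ∈ S, eval (toR a) f = eval (toR b) f}

/-- `T_{N,i} = [0,i-1] ∪ [N-i+1,N]` (so `T_{N,0} = ∅`). -/
def T (N i : ℕ) : Finset ℕ := Finset.range i ∪ Finset.Icc (N - i + 1) N

/-- `E` is `(d,i)`-admitting: `E ∪ T_{N,i} ≠ [0,N]` and `|E \ T_{N,i}| ≤ d - i`. -/
def Admitting (N d i : ℕ) (E : Finset ℕ) : Prop :=
  E ∪ T N i ≠ Finset.range (N + 1) ∧ (E \ T N i).card ≤ d - i

/-- `E` is `d`-admitting: `(d,i)`-admitting for some `i ∈ [0,d]`. -/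
def DAdmitting (N d : ℕ) (E : Finset ℕ) : Prop :=
  ∃ i ≤ d, Admitting N d i E

/-- The operator `L_{N,d}`: if `E = {t₁ < ⋯ < t_s}` with `s ≥ d+1`, then
`L_{N,d}(E) = [0, t_{s-d}] ∪ E ∪ [t_{d+1}, N]`, and `L_{N,d}(E) = E` if `s ≤ d`.
(For `E ⊆ [0,N]`, `j ≤ t_{s-d}` iff `E` has at least `d+1` elements `≥ j`, and
`t_{d+1} ≤ j` iff `E` has at least `d+1` elements `≤ j`.) -/
def Lop (N d : ℕ) (E : Finset ℕ) : Finset ℕ :=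
  E ∪ (Finset.range (N + 1)).filter fun j =>
    d + 1 ≤ (E.filter fun t => j ≤ t).card ∨ d + 1 ≤ (E.filter fun t => t ≤ j).card

/-- `L̄_{N,d}(E) = ⋃ₘ L_{N,d}^m(E)`, the union of all iterates of `L_{N,d}` on `E`. -/
def Lbar (N d : ℕ) (E : Finset ℕ) : Set ℕ :=
  ⋃ m : ℕ, ((Lop N d)^[m] E : Set ℕ)

/-- `P` is a (possibly empty) product of polynomials of total degree at most 1. -/
def ProdLinear (n : ℕ) (P : MvPolynomial (Fin n) ℝ) : Prop :=
  ∃ (m : ℕ) (ℓ : Fin m → MvPolynomial (Fin n) ℝ),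
    (∀ t, (ℓ t).totalDegree ≤ 1) ∧ P = ∏ t, ℓ t

/-- The degree-`d` h-closure of `S ⊆ G`. -/
def hcl (n : ℕ) (k : Fin n → ℕ) (d : ℕ) (S : Set (Fin n → ℕ)) : Set (Fin n → ℕ) :=
  {a ∈ gridSet n k | ∀ P : MvPolynomial (Fin n) ℝ, ProdLinear n P → P.totalDegree ≤ d →
    (∀ x ∈ S, eval (toR x) P = 0) → eval (toR a) P = 0}

theorem subset_Lop (N d : ℕ) (E : Finset ℕ) : E ⊆ Lop N d E :=
  Finset.subset_union_left

theorem Lop_subset_range {N d : ℕ} {E : Finset ℕ} (hE : E ⊆ Finset.range (N + 1)) :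
    Lop N d E ⊆ Finset.range (N + 1) :=
  Finset.union_subset hE (Finset.filter_subset _ _)

theorem T_subset_range {N i : ℕ} (hi : i ≤ N) : T N i ⊆ Finset.range (N + 1) := by
  intro x hx
  simp only [T, Finset.mem_union, Finset.mem_range, Finset.mem_Icc] at hx ⊢
  omega

/-- If `E` has at most `d - i` elements outside `T_{N,i}`, then `L_{N,d}` adds to `E` only
elements of `T_{N,i}`. -/
theorem Lop_sdiff_T_subset {N d i : ℕ} (hi : i ≤ d) (hd : d ≤ N) {E : Finset ℕ}
    (hc : (E \ T N i).card ≤ d - i) :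
    Lop N d E \ T N i ⊆ E := by
  have card_le {F B : Finset ℕ} (hB : B.card ≤ i) (hF : F ⊆ (E \ T N i) ∪ B) :
      F.card ≤ d := by
    have h₁ := Finset.card_le_card hF
    have h₂ := Finset.card_union_le (E \ T N i) B
    omega
  intro j hj
  rw [Finset.mem_sdiff, Lop, Finset.mem_union, Finset.mem_filter] at hj
  obtain ⟨hj | ⟨hjN, hj⟩, hjT⟩ := hj
  · exact hj
  exfalso
  simp only [T, Finset.mem_union, Finset.mem_range, Finset.mem_Icc, not_or] at hjT hjN
  rcases hj with hj | hj
  · refine absurd (card_le (B := Finset.Icc (N - i + 1) N) ?_ ?_) (Nat.not_le.mpr hj)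
    · rw [Nat.card_Icc]
      omega
    · intro x hx
      obtain ⟨hxE, hjx⟩ := Finset.mem_filter.mp hx
      simp only [T, Finset.mem_union, Finset.mem_sdiff, Finset.mem_range, Finset.mem_Icc, hxE,
        true_and]
      omega
  · refine absurd (card_le (B := Finset.range i) (Finset.card_range i).le ?_)
      (Nat.not_le.mpr hj)
    intro x hx
    obtain ⟨hxE, hjx⟩ := Finset.mem_filter.mp hx
    simp only [T, Finset.mem_union, Finset.mem_sdiff, Finset.mem_range, Finset.mem_Icc, hxE,
      true_and]
    omega

/-- `E` is `(d,i)`-admitting iff `L_{N,d}(E)` is `(d,i)`-admitting. -/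
theorem stmt15 (N d i : ℕ) (hi : i ≤ d) (hd : d ≤ N) (E : Finset ℕ)
    (hE : E ⊆ Finset.range (N + 1)) :
    Admitting N d i E ↔ Admitting N d i (Lop N d E) := by
  constructor
  · rintro ⟨hne, hc⟩
    have hsub := Lop_sdiff_T_subset hi hd hc
    refine ⟨fun h => hne ?_, (Finset.card_le_card fun x hx => ?_).trans hc⟩
    · rw [← h]
      refine (Finset.union_subset_union_left (subset_Lop N d E)).antisymm fun x hx => ?_
      by_cases hxT : x ∈ T N i
      · exact Finset.mem_union_right _ hxT
      · exact Finset.mem_union_left _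
          (hsub (Finset.mem_sdiff.mpr ⟨(Finset.mem_union.mp hx).resolve_right hxT, hxT⟩))
    · exact Finset.mem_sdiff.mpr ⟨hsub hx, (Finset.mem_sdiff.mp hx).2⟩
  · rintro ⟨hne, hc⟩
    refine ⟨fun h => hne ?_, (Finset.card_le_card
      (Finset.sdiff_subset_sdiff (subset_Lop N d E) subset_rfl)).trans hc⟩
    refine (Finset.union_subset (Lop_subset_range hE) (T_subset_range (hi.trans hd))).antisymm ?_
    rw [← h]
    exact Finset.union_subset_union_left (subset_Lop N d E)

end CoveringSymmetric
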